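/- Let I ⊂ R = k[x,y,z] be the radical ideal of a set X of n distinct points of P² in tight generic n-position with initial degree s ≥ 2, and write n = C(s+1,2) + h with 0 ≤ h ≤ s. Then the minimal graded free resolution of I is: 0 → R(−s−1)^{s−2h} ⊕ R(−s−2)^{h} → R(−s)^{s−h+1} → I → 0 if 0 ≤ h ≤ s/2, and 0 → R(−s−2)^{h} → R(−s)^{s−h+1} ⊕ R(−s−1)^{2h−s} → I → 0 if s/2 < h ≤ s. In particular, if 0 ≤ h ≤ s/2 then I is minimally generated by s−h+1 forms of degree s, while if s/2 < h ≤ s then I is minimally generated by s−h+1 forms of degree s together with 2h−s forms of degree s+1. -/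

import Mathlib

open Matrix MvPolynomial

noncomputable section

def idealHeight {A : Type*} [CommRing A] (I : Ideal A) : ℕ∞ :=
  ⨅ (P : PrimeSpectrum A) (_ : I ≤ P.asIdeal), Order.height P

def minorsIdeal {A : Type*} [CommRing A] {p q : ℕ} (t : ℕ)
    (M : Matrix (Fin p) (Fin q) A) : Ideal A :=
  Ideal.span { x | ∃ (r : Fin t → Fin p) (c : Fin t → Fin q),
    Function.Injective r ∧ Function.Injective c ∧ x = (M.submatrix r c).det }

/-- Condition `G_s` of Artin–Nagata: for every prime `P ⊇ L` with `ht P ≤ s − 1`,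
the localization `L_P` can be generated by at most `ht P` elements. -/
def CondG {A : Type*} [CommRing A] (L : Ideal A) (s : ℕ) : Prop :=
  ∀ P : Ideal A, P.IsPrime → L ≤ P → idealHeight P + 1 ≤ (s : ℕ∞) →
    ∃ c : ℕ, (c : ℕ∞) ≤ idealHeight P ∧ ∃ g : Fin c → A, (∀ i, g i ∈ L) ∧
      ∀ x ∈ L, ∃ u ∉ P, u * x ∈ Ideal.span (Set.range g)

/-- The skew-symmetric matrix of signed `m × m` minors (obtained by omitting two columns)
of an `m × (m+2)` matrix; this is the middle differential of the Buchsbaum–Rim complex. -/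
def bbrim {A : Type*} [CommRing A] {m : ℕ} (ψ : Matrix (Fin m) (Fin (m + 2)) A) :
    Matrix (Fin (m + 2)) (Fin (m + 2)) A :=
  Matrix.of fun i j =>
    if h : (i : ℕ) < (j : ℕ) then
      (-1) ^ ((i : ℕ) + (j : ℕ)) *
        (ψ.submatrix id (fun q => j.succAbove
          ((⟨(i : ℕ), by have := j.isLt; omega⟩ : Fin (m + 1)).succAbove q))).det
    else if h' : (j : ℕ) < (i : ℕ) then
      (-1) ^ ((i : ℕ) + (j : ℕ) + 1) *
        (ψ.submatrix id (fun q => i.succAbove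
          ((⟨(j : ℕ), by have := i.isLt; omega⟩ : Fin (m + 1)).succAbove q))).det
    else 0

def rowMap {A : Type*} [CommRing A] {ι : Type*} [Fintype ι] (g : ι → A) :
    (ι → A) →ₗ[A] A :=
  ∑ i, g i • LinearMap.proj i

/-- Data of a (necessarily minimal) graded free resolution
`0 → ⊕_j R(−a_j) → ⊕_i R(−b_i) → I → 0` of an ideal of a polynomial ring. -/
def HasResolutionData {A : Type*} [CommRing A] {σ : Type*} (I : Ideal (MvPolynomial σ A))
    {N M : ℕ} (b : Fin N → ℕ) (a : Fin M → ℕ) : Prop :=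
  ∃ (g : Fin N → MvPolynomial σ A) (φ : Matrix (Fin N) (Fin M) (MvPolynomial σ A)),
    (∀ i, (g i).IsHomogeneous (b i)) ∧ Ideal.span (Set.range g) = I ∧
    (∀ i j, (φ i j).IsHomogeneous (a j - b i) ∧ (a j ≤ b i → φ i j = 0)) ∧
    Function.Injective φ.mulVecLin ∧
    LinearMap.range φ.mulVecLin = LinearMap.ker (rowMap g)

/-- The Castelnuovo–Mumford regularity of a codimension-two perfect ideal, read off from
its minimal graded free resolution `0 → ⊕_j R(−a_j) → ⊕_i R(−b_i) → I → 0` as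
`max(max_i b_i, max_j a_j − 1)`. -/
def HasRegularity {A : Type*} [CommRing A] {σ : Type*} (I : Ideal (MvPolynomial σ A))
    (r : ℕ) : Prop :=
  ∃ (N M : ℕ) (b : Fin N → ℕ) (a : Fin M → ℕ), HasResolutionData I b a ∧
    (Finset.univ.sup b) ⊔ ((Finset.univ.sup a) - 1) = r

def IsCohenMacaulayRing (A : Type*) [CommRing A] : Prop :=
  ∀ P : Ideal A, P.IsMaximal → ∃ rs : List A,
    (∀ x ∈ rs, x ∈ P) ∧ RingTheory.Sequence.IsRegular A rs ∧
      (rs.length : ℕ∞) = idealHeight P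

def reesPresentation {A : Type*} [CommRing A] {n : ℕ} (f : Fin n → A) :
    MvPolynomial (Fin n) A →ₐ[A] Polynomial A :=
  MvPolynomial.aeval fun i => Polynomial.C (f i) * Polynomial.X

def Ideal.IsLinearType {A : Type*} [CommRing A] (I : Ideal A) : Prop :=
  ∀ (n : ℕ) (f : Fin n → A), Ideal.span (Set.range f) = I →
    RingHom.ker (reesPresentation f) =
      Ideal.span {p | p ∈ RingHom.ker (reesPresentation f) ∧ p.IsHomogeneous 1}

def moduleDepth {A : Type*} [CommRing A] (J : Ideal A) (M : Type*)
    [AddCommGroup M] [Module A M] : ℕ∞ :=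
  sSup {c : ℕ∞ | ∃ rs : List A, (∀ x ∈ rs, x ∈ J) ∧
    RingTheory.Sequence.IsRegular M rs ∧ (rs.length : ℕ∞) = c}

def analyticSpread {A : Type*} [CommRing A] (m I : Ideal A) : WithBot ℕ∞ :=
  ringKrullDim ((reesAlgebra I) ⧸ (Ideal.map (algebraMap A (reesAlgebra I)) m))

section Points

variable {k : Type*} [Field k]

def gradedPiece (I : Ideal (MvPolynomial (Fin 3) k)) (t : ℕ) :
    Submodule k (MvPolynomial (Fin 3) k) :=
  Submodule.restrictScalars k I ⊓ homogeneousSubmodule (Fin 3) k t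

def pointIdeal (p : Fin 3 → k) : Ideal (MvPolynomial (Fin 3) k) :=
  Ideal.span {f | f.IsHomogeneous 1 ∧ MvPolynomial.eval p f = 0}

def vanishingIdeal {n : ℕ} (pts : Fin n → (Fin 3 → k)) : Ideal (MvPolynomial (Fin 3) k) :=
  ⨅ i, pointIdeal (pts i)

def oneTimesPiece (I : Ideal (MvPolynomial (Fin 3) k)) (s : ℕ) :
    Submodule k (MvPolynomial (Fin 3) k) :=
  Submodule.span k {g | ∃ ℓ f, ℓ ∈ homogeneousSubmodule (Fin 3) k 1 ∧
    f ∈ gradedPiece I s ∧ g = ℓ * f}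

def IsPointFamily {n : ℕ} (pts : Fin n → (Fin 3 → k)) : Prop :=
  (∀ i, pts i ≠ 0) ∧ ∀ i j, i ≠ j → ∀ c : k, pts i ≠ c • pts j

def InGenericPosition {n : ℕ} (pts : Fin n → (Fin 3 → k)) : Prop :=
  ∀ t : ℕ, Module.finrank k (gradedPiece (vanishingIdeal pts) t) = (t + 2).choose 2 - n

def InUniformPosition {n : ℕ} (pts : Fin n → (Fin 3 → k)) : Prop :=
  ∀ T : Finset (Fin n), ∀ t : ℕ,
    Module.finrank k (gradedPiece (⨅ i ∈ T, pointIdeal (pts i)) t) = (t + 2).choose 2 - T.card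

def HasInitialDegree (I : Ideal (MvPolynomial (Fin 3) k)) (s : ℕ) : Prop :=
  gradedPiece I s ≠ ⊥ ∧ ∀ t < s, gradedPiece I t = ⊥

def InTightGenericPosition {n : ℕ} (pts : Fin n → (Fin 3 → k)) (s : ℕ) : Prop :=
  InGenericPosition pts ∧
    Module.finrank k (oneTimesPiece (vanishingIdeal pts) s) =
      min (3 * Module.finrank k (gradedPiece (vanishingIdeal pts) s))
        (Module.finrank k (gradedPiece (vanishingIdeal pts) (s + 1)))

def IsBirationalOntoImage {N : ℕ} (f : Fin N → MvPolynomial (Fin 3) k) : Prop :=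
  ∃ (e : ℕ) (G : Fin 3 → MvPolynomial (Fin N) k) (w : MvPolynomial (Fin 3) k),
    w ≠ 0 ∧ (∀ j, (G j).IsHomogeneous e) ∧
      ∀ j, MvPolynomial.aeval f (G j) = w * MvPolynomial.X j

end Points

end

section PolynomialRing

variable {k : Type*} [Field k]

theorem homogeneousComponent_mul_of_isHomogeneous {σ A : Type*} [CommSemiring A]
    {ℓ : MvPolynomial σ A} {m : ℕ} (hℓ : ℓ.IsHomogeneous m) (f : MvPolynomial σ A) (t : ℕ) :
    homogeneousComponent (t + m) (ℓ * f) = ℓ * homogeneousComponent t f := by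
  let := MvPolynomial.gradedAlgebra (σ := σ) (R := A)
  have h := DirectSum.coe_decompose_mul_of_left_mem_of_le (homogeneousSubmodule σ A) (b := f)
    (n := t + m) hℓ (Nat.le_add_left _ _)
  rw [Nat.add_sub_cancel] at h
  have key (p : MvPolynomial σ A) (i : ℕ) :
      ((DirectSum.decompose (homogeneousSubmodule σ A) p) i : MvPolynomial σ A) =
        homogeneousComponent i p :=
    decomposition.decompose'_apply p i
  simpa only [key] using h

/-- The graded piece of degree `t` of the twist `R(-b)`. -/
noncomputable def twistedPiece (k : Type*) [Field k] (b t : ℕ) : Submodule k (MvPolynomial (Fin 3) k) :=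
  if b ≤ t then homogeneousSubmodule (Fin 3) k (t - b) else ⊥

/-- The linear form `z + a x + b y`. -/
noncomputable def slantedForm (a b : k) : MvPolynomial (Fin 3) k := X 2 + C a * X 0 + C b * X 1

theorem slantedForm_isHomogeneous (a b : k) : (slantedForm a b).IsHomogeneous 1 :=
  ((isHomogeneous_X _ _).add (isHomogeneous_C_mul_X _ _)).add (isHomogeneous_C_mul_X _ _)

theorem slantedForm_ne_zero (a b : k) : slantedForm a b ≠ 0 := by
  intro h
  have := congrArg (MvPolynomial.eval (Pi.single 2 1)) h
  simp [slantedForm] at this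

theorem not_X_one_dvd_slantedForm (a b : k) : ¬ X 1 ∣ slantedForm a b := by
  rintro ⟨f, h⟩
  have := congrArg (MvPolynomial.eval (Pi.single 2 1)) h
  simp [slantedForm] at this

theorem mul_mem_twistedPiece {ℓ f : MvPolynomial (Fin 3) k} (hℓ : ℓ.IsHomogeneous 1) {b t : ℕ}
    (hf : f ∈ twistedPiece k b t) : ℓ * f ∈ twistedPiece k b (t + 1) := by
  unfold twistedPiece at hf ⊢
  split_ifs at hf with h
  · rw [if_pos (by omega)]
    have := hℓ.mul hf
    rwa [show 1 + (t - b) = t + 1 - b by omega] at this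
  · rw [(Submodule.mem_bot k).1 hf, mul_zero]
    exact zero_mem _

theorem exists_eq_X_mul_add {f : MvPolynomial (Fin 3) k} {t : ℕ} (hf : f.IsHomogeneous (t + 1)) :
    ∃ u v w : MvPolynomial (Fin 3) k, u.IsHomogeneous t ∧ v.IsHomogeneous t ∧ w.IsHomogeneous t ∧
      f = X 0 * u + X 1 * v + X 2 * w := by
  have hmem : f ∈ Ideal.span (X '' Set.univ : Set (MvPolynomial (Fin 3) k)) := by
    rw [mem_ideal_span_X_image]
    intro m hm
    by_contra! hcon
    have h0 : m = 0 := by ext i; simpa using hcon i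
    have := hf.degree_eq_sum_deg_support hm
    simp [h0] at this
  have himage : (X '' Set.univ : Set (MvPolynomial (Fin 3) k)) = {X 0, X 1, X 2} := by
    ext p; simp [Fin.exists_fin_succ, eq_comm]
  rw [himage, Ideal.mem_span_insert] at hmem
  obtain ⟨u, q, hq, rfl⟩ := hmem
  obtain ⟨v, w, rfl⟩ := Ideal.mem_span_pair.1 hq
  refine ⟨homogeneousComponent t u, homogeneousComponent t v, homogeneousComponent t w,
    homogeneousComponent_isHomogeneous _ _, homogeneousComponent_isHomogeneous _ _,
    homogeneousComponent_isHomogeneous _ _, ?_⟩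
  rw [← homogeneousComponent_eq_self hf]
  simp only [map_add, mul_comm u, mul_comm v, mul_comm w,
    homogeneousComponent_mul_of_isHomogeneous (isHomogeneous_X k _)]
  ring

theorem exists_eq_slantedForm_mul_add (a b : k) {f : MvPolynomial (Fin 3) k} {t : ℕ}
    (hf : f.IsHomogeneous (t + 1)) :
    ∃ u v w : MvPolynomial (Fin 3) k, u.IsHomogeneous t ∧ v.IsHomogeneous t ∧ w.IsHomogeneous t ∧
      f = X 0 * u + X 1 * v + slantedForm a b * w := by
  obtain ⟨u, v, w, hu, hv, hw, rfl⟩ := exists_eq_X_mul_add hf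
  refine ⟨u - C a * w, v - C b * w, w, hu.sub (hw.C_mul a), hv.sub (hw.C_mul b), hw, ?_⟩
  unfold slantedForm
  ring

/-- Exactness in the middle of the Koszul complex on `x, y, z`. -/
theorem exists_koszul_X {A B D : MvPolynomial (Fin 3) k} (h : X 0 * A + X 1 * B + X 2 * D = 0) :
    ∃ c d e : MvPolynomial (Fin 3) k, A = X 1 * c + X 2 * d ∧ B = -(X 0 * c) + X 2 * e ∧
      D = -(X 0 * d + X 1 * e) := by
  have himage : (X '' ({0, 1} : Set (Fin 3)) : Set (MvPolynomial (Fin 3) k)) = {X 0, X 1} := by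
    simp [Set.image_pair]
  have hD : D ∈ Ideal.span (X '' ({0, 1} : Set (Fin 3)) : Set (MvPolynomial (Fin 3) k)) := by
    have hmul : X 2 * D ∈
        Ideal.span (X '' ({0, 1} : Set (Fin 3)) : Set (MvPolynomial (Fin 3) k)) := by
      rw [himage, Ideal.mem_span_pair]
      exact ⟨-A, -B, by linear_combination -h⟩
    rw [mem_ideal_span_X_image] at hmul ⊢
    intro m hm
    obtain ⟨i, hi, hne⟩ := hmul (Finsupp.single 2 1 + m) (by
      rw [mem_support_iff, coeff_X_mul]; exact mem_support_iff.1 hm)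
    refine ⟨i, hi, ?_⟩
    rcases hi with rfl | rfl <;> simpa using hne
  rw [himage, Ideal.mem_span_pair] at hD
  obtain ⟨d, e, hde⟩ := hD
  have h1 : X 1 ∣ X 0 * (A + X 2 * d) := ⟨-(B + X 2 * e), by
    linear_combination h + X 2 * hde⟩
  have h2 : X 1 ∣ A + X 2 * d := by
    refine (X_prime.dvd_or_dvd h1).resolve_left ?_
    rw [X_dvd_X]
    simp
  obtain ⟨c, hc⟩ := h2
  refine ⟨c, -d, -e, by linear_combination hc, ?_, by linear_combination -hde⟩
  have : (X 1 : MvPolynomial (Fin 3) k) * (B + X 0 * c + X 2 * e) = 0 := by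
    linear_combination h + X 2 * hde - X 0 * hc
  have := (mul_eq_zero.1 this).resolve_left (X_ne_zero _)
  linear_combination this

theorem exists_koszul_slantedForm (a b : k) {A B D : MvPolynomial (Fin 3) k}
    (h : X 0 * A + X 1 * B + slantedForm a b * D = 0) :
    ∃ c d e : MvPolynomial (Fin 3) k, A = X 1 * c + slantedForm a b * d ∧
      B = -(X 0 * c) + slantedForm a b * e ∧ D = -(X 0 * d + X 1 * e) := by
  obtain ⟨c, d, e, h1, h2, h3⟩ := exists_koszul_X (A := A + C a * D) (B := B + C b * D) (D := D)
    (by unfold slantedForm at h; linear_combination h)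
  refine ⟨c + C a * e - C b * d, d, e, ?_, ?_, h3⟩
  · unfold slantedForm
    linear_combination h1 - C a * h3
  · unfold slantedForm
    linear_combination h2 - C b * h3

theorem exists_koszul_twistedPiece (a b : k) {β t : ℕ} {A B D : MvPolynomial (Fin 3) k}
    (hA : A ∈ twistedPiece k β (t + 1)) (hB : B ∈ twistedPiece k β (t + 1))
    (hD : D ∈ twistedPiece k β (t + 1))
    (h : X 0 * A + X 1 * B + slantedForm a b * D = 0) :
    ∃ c d e : MvPolynomial (Fin 3) k, c ∈ twistedPiece k β t ∧ d ∈ twistedPiece k β t ∧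
      e ∈ twistedPiece k β t ∧ A = X 1 * c + slantedForm a b * d ∧
      B = -(X 0 * c) + slantedForm a b * e ∧ D = -(X 0 * d + X 1 * e) := by
  have hX (i : Fin 3) : (X i : MvPolynomial (Fin 3) k).IsHomogeneous 1 := isHomogeneous_X k i
  have hℓ := slantedForm_isHomogeneous a b
  obtain ⟨c, d, e, h1, h2, h3⟩ := exists_koszul_slantedForm a b h
  unfold twistedPiece at *
  by_cases hβ : β ≤ t
  · rw [if_pos (by omega), show t + 1 - β = t - β + 1 by omega] at hA hB hD
    rw [if_pos hβ]
    refine ⟨homogeneousComponent (t - β) c, homogeneousComponent (t - β) d,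
      homogeneousComponent (t - β) e, homogeneousComponent_mem _ _, homogeneousComponent_mem _ _,
      homogeneousComponent_mem _ _, ?_, ?_, ?_⟩
    · rw [← homogeneousComponent_eq_self hA, h1]
      simp [homogeneousComponent_mul_of_isHomogeneous, hX, hℓ]
    · rw [← homogeneousComponent_eq_self hB, h2]
      simp [homogeneousComponent_mul_of_isHomogeneous, hX, hℓ]
    · rw [← homogeneousComponent_eq_self hD, h3]
      simp [homogeneousComponent_mul_of_isHomogeneous, hX]
  · have key {F : MvPolynomial (Fin 3) k} (hF : F ∈ if β ≤ t + 1 then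
        homogeneousSubmodule (Fin 3) k (t + 1 - β) else ⊥)
        (hF0 : MvPolynomial.eval 0 F = 0) : F = 0 := by
      split_ifs at hF with hβ'
      · rw [show t + 1 - β = 0 by omega, homogeneousSubmodule_zero] at hF
        obtain ⟨r, rfl⟩ := Submodule.mem_one.1 hF
        simp only [algebraMap_eq, eval_C] at hF0
        simp [hF0]
      · exact (Submodule.mem_bot k).1 hF
    have hA0 : A = 0 := key hA (by rw [h1]; simp [slantedForm])
    have hB0 : B = 0 := key hB (by rw [h2]; simp [slantedForm])
    have hD0 : D = 0 := key hD (by rw [h3]; simp)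
    exact ⟨0, 0, 0, zero_mem _, zero_mem _, zero_mem _, by simp [hA0], by simp [hB0],
      by simp [hD0]⟩

theorem finrank_homogeneousSubmodule_fin_three (t : ℕ) :
    Module.finrank k (homogeneousSubmodule (Fin 3) k t) = (t + 2).choose 2 := by
  rw [homogeneousSubmodule_eq_finsupp_supported]
  have e : ({d : Fin 3 →₀ ℕ | d.degree = t}) =
      ((Finset.univ : Finset (Fin 3)).finsuppAntidiag t : Set (Fin 3 →₀ ℕ)) := by
    ext d
    simp [Finset.mem_finsuppAntidiag, Finsupp.degree_eq_sum]
  rw [(AddMonoidAlgebra.supportedEquivFinsupp _).finrank_eq, e, Module.finrank_finsupp_self]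
  simp only [Finset.coe_sort_coe, Fintype.card_coe]
  rw [Finset.card_finsuppAntidiag_nat_eq_choose, Finset.card_univ, Fintype.card_fin, show 3 + t - 1 = t + 2 by omega,
    Nat.choose_symm_add]

instance (t : ℕ) : Module.Finite k (homogeneousSubmodule (Fin 3) k t) :=
  Module.Finite.iff_fg.2 (homogeneousSubmodule_fg _ _ t)

end PolynomialRing

section PointIdeals

variable {k : Type*} [Field k]

/-- Restriction of polynomials to the line through the origin spanned by `p`. -/
noncomputable def lineRestriction (p : Fin 3 → k) : MvPolynomial (Fin 3) k →ₐ[k] Polynomial k :=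
  aeval fun i => Polynomial.C (p i) * Polynomial.X

theorem lineRestriction_of_isHomogeneous_one (p : Fin 3 → k) {f : MvPolynomial (Fin 3) k}
    (hf : f.IsHomogeneous 1) :
    lineRestriction p f = Polynomial.C (MvPolynomial.eval p f) * Polynomial.X := by
  have hf' : f ∈ Submodule.span k (Set.range (X : Fin 3 → MvPolynomial (Fin 3) k)) := by
    rwa [← homogeneousSubmodule_one_eq_span_X]
  clear hf
  induction hf' using Submodule.span_induction with
  | mem x hx =>
    obtain ⟨i, rfl⟩ := hx
    simp [lineRestriction]
  | zero => simp
  | add x y _ _ hx hy => rw [map_add, hx, hy, map_add, Polynomial.C_add, add_mul]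
  | smul c x _ hx => rw [map_smul, hx, smul_eval, Polynomial.C_mul, mul_assoc,
      Polynomial.smul_eq_C_mul]

theorem pointIdeal_eq_ker {p : Fin 3 → k} (hp : p ≠ 0) :
    pointIdeal p = RingHom.ker (lineRestriction p) := by
  apply le_antisymm
  · refine Ideal.span_le.2 ?_
    rintro f ⟨hf, hfp⟩
    simp [lineRestriction_of_isHomogeneous_one p hf, hfp, RingHom.mem_ker]
  · intro f hf
    obtain ⟨j, hj⟩ := Function.ne_iff.1 hp
    have hj : p j ≠ 0 := hj
    have hcongr : (Ideal.Quotient.mkₐ k (pointIdeal p)) =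
        ((Ideal.Quotient.mkₐ k (pointIdeal p)).comp
          (Polynomial.aeval (C (p j)⁻¹ * X j))).comp (lineRestriction p) := by
      ext i
      simp only [AlgHom.comp_apply, lineRestriction, aeval_X, map_mul, Polynomial.aeval_C,
        Polynomial.aeval_X]
      rw [← map_mul]
      refine (Ideal.Quotient.mk_eq_mk_iff_sub_mem _ _).2 (Ideal.subset_span ⟨?_, ?_⟩)
      · refine (isHomogeneous_X k i).sub ?_
        simp only [algebraMap_eq]
        rw [← mul_assoc, ← C_mul]
        exact isHomogeneous_C_mul_X _ _
      · simp [hj]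
    have := DFunLike.congr_fun hcongr f
    rw [AlgHom.comp_apply, (RingHom.mem_ker).1 hf, map_zero] at this
    exact Ideal.Quotient.eq_zero_iff_mem.1 this

theorem mem_pointIdeal_of_mul_mem {p : Fin 3 → k} (hp : p ≠ 0) {ℓ f : MvPolynomial (Fin 3) k}
    (hℓ : ℓ.IsHomogeneous 1) (hne : MvPolynomial.eval p ℓ ≠ 0) (h : ℓ * f ∈ pointIdeal p) :
    f ∈ pointIdeal p := by
  rw [pointIdeal_eq_ker hp, RingHom.mem_ker] at h ⊢
  rw [map_mul, lineRestriction_of_isHomogeneous_one p hℓ] at h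
  exact (mul_eq_zero.1 h).resolve_left (by simp [hne])

theorem homogeneousComponent_mem_vanishingIdeal {n : ℕ} (pts : Fin n → (Fin 3 → k))
    {f : MvPolynomial (Fin 3) k} (hf : f ∈ vanishingIdeal pts) (t : ℕ) :
    homogeneousComponent t f ∈ vanishingIdeal pts := by
  let := MvPolynomial.gradedAlgebra (σ := Fin 3) (R := k)
  refine homogeneousComponent_mem_of_mem (Ideal.IsHomogeneous.iInf fun i => ?_) hf t
  exact Ideal.homogeneous_span _ _ fun g hg => ⟨1, hg.1⟩

theorem exists_slantedForm_eval_ne_zero [Infinite k] {n : ℕ} (pts : Fin n → (Fin 3 → k))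
    (hpts : ∀ i, pts i ≠ 0) :
    ∃ a b : k, ∀ i, MvPolynomial.eval (pts i) (slantedForm a b) ≠ 0 := by
  let q (i : Fin n) : Polynomial k := Polynomial.C (pts i 2) +
    Polynomial.C (pts i 0) * Polynomial.X + Polynomial.C (pts i 1) * Polynomial.X ^ 2
  have hq (i : Fin n) : q i ≠ 0 := by
    intro h
    apply hpts i
    have h0 := congrArg (Polynomial.coeff · 0) h
    have h1 := congrArg (Polynomial.coeff · 1) h
    have h2 := congrArg (Polynomial.coeff · 2) h
    simp [q, Polynomial.coeff_X, Polynomial.coeff_X_pow, Polynomial.coeff_C] at h0 h1 h2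
    ext j
    fin_cases j <;> simp [h0, h1, h2]
  obtain ⟨a, ha⟩ := Polynomial.exists_eval_ne_zero_of_natDegree_lt_card (∏ i, q i)
    (Finset.prod_ne_zero_iff.2 fun i _ => hq i)
    ((Cardinal.natCast_lt_aleph0).trans_le (Cardinal.aleph0_le_mk k))
  refine ⟨a, a ^ 2, fun i h => ha ?_⟩
  rw [Polynomial.eval_prod]
  refine Finset.prod_eq_zero (Finset.mem_univ i) ?_
  simp only [slantedForm, map_add, map_mul, eval_X, eval_C] at h
  simp only [q, Polynomial.eval_add, Polynomial.eval_mul, Polynomial.eval_C, Polynomial.eval_X,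
    Polynomial.eval_pow]
  linear_combination h

end PointIdeals

section Syzygies

variable {k : Type*} [Field k] {N : ℕ}

theorem rowMap_apply {A : Type*} [CommRing A] {ι : Type*} [Fintype ι] (g v : ι → A) :
    rowMap g v = ∑ i, g i * v i := by
  simp [rowMap]

theorem range_rowMap {A : Type*} [CommRing A] {ι : Type*} [Fintype ι] (g : ι → A) :
    LinearMap.range (rowMap g) = Ideal.span (Set.range g) := by
  ext f
  rw [LinearMap.mem_range, Ideal.mem_span_range_iff_exists_fun]
  simp only [rowMap_apply, mul_comm]

/-- The degree `t` piece of the graded free module `⊕ᵢ R(-bᵢ)`. -/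
noncomputable def freePiece (k : Type*) [Field k] (b : Fin N → ℕ) (t : ℕ) :
    Submodule k (Fin N → MvPolynomial (Fin 3) k) :=
  Submodule.pi Set.univ fun i => twistedPiece k (b i) t

theorem mem_freePiece {b : Fin N → ℕ} {t : ℕ} {v : Fin N → MvPolynomial (Fin 3) k} :
    v ∈ freePiece k b t ↔ ∀ i, v i ∈ twistedPiece k (b i) t := by
  simp [freePiece, Submodule.mem_pi]

/-- The degree `t` piece of the module of syzygies of `g`. -/
noncomputable def syzygyPiece (g : Fin N → MvPolynomial (Fin 3) k) (b : Fin N → ℕ) (t : ℕ) :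
    Submodule k (Fin N → MvPolynomial (Fin 3) k) :=
  freePiece k b t ⊓ (LinearMap.ker (rowMap g)).restrictScalars k

theorem mem_syzygyPiece {g : Fin N → MvPolynomial (Fin 3) k} {b : Fin N → ℕ} {t : ℕ}
    {v : Fin N → MvPolynomial (Fin 3) k} :
    v ∈ syzygyPiece g b t ↔ v ∈ freePiece k b t ∧ rowMap g v = 0 := by
  simp [syzygyPiece]

theorem smul_mem_freePiece {ℓ : MvPolynomial (Fin 3) k} (hℓ : ℓ.IsHomogeneous 1)
    {b : Fin N → ℕ} {t : ℕ} {v : Fin N → MvPolynomial (Fin 3) k} (hv : v ∈ freePiece k b t) :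
    ℓ • v ∈ freePiece k b (t + 1) := by
  rw [mem_freePiece] at hv ⊢
  exact fun i => mul_mem_twistedPiece hℓ (hv i)

theorem smul_mem_syzygyPiece {ℓ : MvPolynomial (Fin 3) k} (hℓ : ℓ.IsHomogeneous 1)
    {g : Fin N → MvPolynomial (Fin 3) k} {b : Fin N → ℕ} {t : ℕ}
    {v : Fin N → MvPolynomial (Fin 3) k} (hv : v ∈ syzygyPiece g b t) :
    ℓ • v ∈ syzygyPiece g b (t + 1) := by
  rw [mem_syzygyPiece] at hv ⊢
  exact ⟨smul_mem_freePiece hℓ hv.1, by rw [map_smul, hv.2, smul_zero]⟩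

theorem freePiece_eq_bot {b : Fin N → ℕ} {t : ℕ} (h : ∀ i, t < b i) : freePiece k b t = ⊥ := by
  rw [eq_bot_iff]
  intro v hv
  rw [mem_freePiece] at hv
  refine (Submodule.mem_bot k).2 (funext fun i => ?_)
  have := hv i
  rwa [twistedPiece, if_neg (by have := h i; omega)] at this

theorem rowMap_isHomogeneous {g : Fin N → MvPolynomial (Fin 3) k} {b : Fin N → ℕ}
    (hg : ∀ i, (g i).IsHomogeneous (b i)) {t : ℕ} {v : Fin N → MvPolynomial (Fin 3) k}
    (hv : v ∈ freePiece k b t) : (rowMap g v).IsHomogeneous t := by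
  rw [rowMap_apply]
  refine IsHomogeneous.sum _ _ _ fun i _ => ?_
  have := mem_freePiece.1 hv i
  unfold twistedPiece at this
  split_ifs at this with h
  · have := (hg i).mul this
    rwa [Nat.add_sub_cancel' h] at this
  · rw [(Submodule.mem_bot k).1 this, mul_zero]
    exact isHomogeneous_zero _ _ _

theorem exists_freePiece_eq_smul_add (a₀ a₁ : k) {b : Fin N → ℕ} {t : ℕ} (hb : ∀ i, b i ≤ t)
    {v : Fin N → MvPolynomial (Fin 3) k} (hv : v ∈ freePiece k b (t + 1)) :
    ∃ u₀ ∈ freePiece k b t, ∃ u₁ ∈ freePiece k b t, ∃ u₂ ∈ freePiece k b t,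
      v = (X 0 : MvPolynomial (Fin 3) k) • u₀ + (X 1 : MvPolynomial (Fin 3) k) • u₁ +
        slantedForm a₀ a₁ • u₂ := by
  have key (i : Fin N) := exists_eq_slantedForm_mul_add a₀ a₁ (f := v i) (t := t - b i) (by
    have := mem_freePiece.1 hv i
    rwa [twistedPiece, if_pos (by have := hb i; omega),
      show t + 1 - b i = t - b i + 1 by have := hb i; omega] at this)
  choose u₀ u₁ u₂ h₀ h₁ h₂ h using key
  refine ⟨u₀, mem_freePiece.2 fun i => ?_, u₁, mem_freePiece.2 fun i => ?_,
    u₂, mem_freePiece.2 fun i => ?_, funext h⟩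
  all_goals rw [twistedPiece, if_pos (hb i)]
  exacts [h₀ i, h₁ i, h₂ i]

theorem exists_koszul_freePiece (a₀ a₁ : k) {b : Fin N → ℕ} {t : ℕ}
    {u₀ u₁ u₂ : Fin N → MvPolynomial (Fin 3) k} (h₀ : u₀ ∈ freePiece k b (t + 1))
    (h₁ : u₁ ∈ freePiece k b (t + 1)) (h₂ : u₂ ∈ freePiece k b (t + 1))
    (h : (X 0 : MvPolynomial (Fin 3) k) • u₀ + (X 1 : MvPolynomial (Fin 3) k) • u₁ +
      slantedForm a₀ a₁ • u₂ = 0) :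
    ∃ c ∈ freePiece k b t, ∃ d ∈ freePiece k b t, ∃ e ∈ freePiece k b t,
      u₀ = (X 1 : MvPolynomial (Fin 3) k) • c + slantedForm a₀ a₁ • d ∧
      u₁ = -((X 0 : MvPolynomial (Fin 3) k) • c) + slantedForm a₀ a₁ • e ∧
      u₂ = -((X 0 : MvPolynomial (Fin 3) k) • d + (X 1 : MvPolynomial (Fin 3) k) • e) := by
  have key (i : Fin N) := exists_koszul_twistedPiece a₀ a₁ (mem_freePiece.1 h₀ i)
    (mem_freePiece.1 h₁ i) (mem_freePiece.1 h₂ i) (congrFun h i)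
  choose c d e hc hd he H₀ H₁ H₂ using key
  exact ⟨c, mem_freePiece.2 hc, d, mem_freePiece.2 hd, e, mem_freePiece.2 he, funext H₀,
    funext H₁, funext H₂⟩

/-- Properties of a homogeneous ideal `I` of initial degree at least `s` for which the linear form
`z + a₀ x + a₁ y` is regular modulo `I` and generates the degree `> s` part of `R/I`. -/
structure HasRegularSection (I : Ideal (MvPolynomial (Fin 3) k)) (s : ℕ) (a₀ a₁ : k) : Prop where
  homogeneousComponent_mem : ∀ f ∈ I, ∀ t, homogeneousComponent t f ∈ I
  mem_of_mul_mem : ∀ f, slantedForm a₀ a₁ * f ∈ I → f ∈ I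
  exists_sub_mem : ∀ t ≥ s, ∀ f : MvPolynomial (Fin 3) k, f.IsHomogeneous (t + 1) →
    ∃ c : MvPolynomial (Fin 3) k, c.IsHomogeneous t ∧ f - slantedForm a₀ a₁ * c ∈ I
  eq_zero : ∀ f ∈ I, ∀ t < s, f.IsHomogeneous t → f = 0

/-- A system of homogeneous elements of `I` of degrees `s` and `s + 1` spanning `I` in these
degrees, without redundancy in degree `s`. -/
structure IsGeneratorSystem (I : Ideal (MvPolynomial (Fin 3) k)) (s : ℕ)
    (g : Fin N → MvPolynomial (Fin 3) k) (b : Fin N → ℕ) : Prop where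
  degree : ∀ i, b i = s ∨ b i = s + 1
  isHomogeneous : ∀ i, (g i).IsHomogeneous (b i)
  mem : ∀ i, g i ∈ I
  exists_initial : ∀ f ∈ I, f.IsHomogeneous s → ∃ v ∈ freePiece k b s, rowMap g v = f
  exists_succ : ∀ f ∈ I, f.IsHomogeneous (s + 1) → ∃ v ∈ freePiece k b (s + 1), rowMap g v = f
  independent : ∀ v ∈ freePiece k b s, rowMap g v = 0 → v = 0

variable {I : Ideal (MvPolynomial (Fin 3) k)} {s : ℕ} {a₀ a₁ : k}
  {g : Fin N → MvPolynomial (Fin 3) k} {b : Fin N → ℕ}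

theorem IsGeneratorSystem.rowMap_mem (hg : IsGeneratorSystem I s g b)
    (v : Fin N → MvPolynomial (Fin 3) k) : rowMap g v ∈ I := by
  rw [rowMap_apply]
  exact I.sum_mem fun i _ => I.mul_mem_right _ (hg.mem i)

theorem IsGeneratorSystem.degree_le (hg : IsGeneratorSystem I s g b) {t : ℕ} (ht : s + 1 ≤ t)
    (i : Fin N) : b i ≤ t := by
  rcases hg.degree i with h | h <;> omega

theorem IsGeneratorSystem.exists_of_le (hg : IsGeneratorSystem I s g b)
    (hI : HasRegularSection I s a₀ a₁) {t : ℕ} (ht : s + 1 ≤ t) :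
    ∀ f ∈ I, f.IsHomogeneous t → ∃ v ∈ freePiece k b t, rowMap g v = f := by
  induction t, ht using Nat.le_induction with
  | base => exact hg.exists_succ
  | succ t ht ih =>
    intro f hfI hf
    have hX (i : Fin 3) : (X i : MvPolynomial (Fin 3) k).IsHomogeneous 1 := isHomogeneous_X k i
    have hℓ := slantedForm_isHomogeneous a₀ a₁
    obtain ⟨u, v, w, hu, hv, hw, rfl⟩ := exists_eq_slantedForm_mul_add a₀ a₁ hf
    obtain ⟨t, rfl⟩ : ∃ r, t = r + 1 := ⟨t - 1, by omega⟩
    obtain ⟨c, hc, hcI⟩ := hI.exists_sub_mem t (by omega) u hu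
    obtain ⟨d, hd, hdI⟩ := hI.exists_sub_mem t (by omega) v hv
    have hw' : w + X 0 * c + X 1 * d ∈ I := by
      refine hI.mem_of_mul_mem _ ?_
      have := I.sub_mem (I.sub_mem hfI (I.mul_mem_left (X 0) hcI)) (I.mul_mem_left (X 1) hdI)
      convert this using 1
      ring
    have hmul {ℓ q : MvPolynomial (Fin 3) k} (hℓ : ℓ.IsHomogeneous 1) (hq : q.IsHomogeneous t) :
        (ℓ * q).IsHomogeneous (t + 1) := by
      rw [add_comm]; exact hℓ.mul hq
    obtain ⟨p₀, hp₀, e₀⟩ := ih _ hcI (hu.sub (hmul hℓ hc))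
    obtain ⟨p₁, hp₁, e₁⟩ := ih _ hdI (hv.sub (hmul hℓ hd))
    obtain ⟨p₂, hp₂, e₂⟩ := ih _ hw' ((hw.add (hmul (hX 0) hc)).add (hmul (hX 1) hd))
    refine ⟨(X 0 : MvPolynomial (Fin 3) k) • p₀ + (X 1 : MvPolynomial (Fin 3) k) • p₁ +
      slantedForm a₀ a₁ • p₂, add_mem (add_mem (smul_mem_freePiece (hX 0) hp₀)
        (smul_mem_freePiece (hX 1) hp₁)) (smul_mem_freePiece hℓ hp₂), ?_⟩
    simp only [map_add, map_smul, e₀, e₁, e₂, smul_eq_mul]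
    ring

theorem IsGeneratorSystem.span_range_eq (hg : IsGeneratorSystem I s g b)
    (hI : HasRegularSection I s a₀ a₁) : Ideal.span (Set.range g) = I := by
  apply le_antisymm
  · rw [Ideal.span_le]
    rintro _ ⟨i, rfl⟩
    exact hg.mem i
  · intro f hf
    rw [← range_rowMap, ← sum_homogeneousComponent f]
    refine Submodule.sum_mem _ fun t _ => ?_
    have hmem := hI.homogeneousComponent_mem f hf t
    have hhom := homogeneousComponent_isHomogeneous t f
    rcases lt_trichotomy t s with h | h | h
    · rw [hI.eq_zero _ hmem t h hhom]
      exact zero_mem _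
    · subst h
      obtain ⟨v, -, hv⟩ := hg.exists_initial _ hmem hhom
      exact ⟨v, hv⟩
    · obtain ⟨v, -, hv⟩ := hg.exists_of_le hI h _ hmem hhom
      exact ⟨v, hv⟩

theorem IsGeneratorSystem.syzygyPiece_eq_bot (hg : IsGeneratorSystem I s g b) {t : ℕ}
    (ht : t ≤ s) : syzygyPiece g b t = ⊥ := by
  rw [eq_bot_iff]
  intro v hv
  rw [mem_syzygyPiece] at hv
  rcases ht.lt_or_eq with h | rfl
  · rw [← freePiece_eq_bot (k := k) (b := b) (t := t)
      (fun i => by rcases hg.degree i with h' | h' <;> omega)]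
    exact hv.1
  · exact (Submodule.mem_bot k).2 (hg.independent v hv.1 hv.2)

/-- Syzygies of degree at least `s + 3` are combinations of syzygies of smaller degree. -/
theorem IsGeneratorSystem.exists_syzygyPiece_eq_smul_add (hg : IsGeneratorSystem I s g b)
    (hI : HasRegularSection I s a₀ a₁) {t : ℕ} (ht : s + 2 ≤ t)
    {v : Fin N → MvPolynomial (Fin 3) k} (hv : v ∈ syzygyPiece g b (t + 1)) :
    ∃ u₀ ∈ syzygyPiece g b t, ∃ u₁ ∈ syzygyPiece g b t, ∃ u₂ ∈ syzygyPiece g b t,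
      v = (X 0 : MvPolynomial (Fin 3) k) • u₀ + (X 1 : MvPolynomial (Fin 3) k) • u₁ +
        slantedForm a₀ a₁ • u₂ := by
  obtain ⟨t, rfl⟩ : ∃ r, t = r + 1 + 1 := ⟨t - 2, by omega⟩
  have hX (i : Fin 3) : (X i : MvPolynomial (Fin 3) k).IsHomogeneous 1 := isHomogeneous_X k i
  have hℓ := slantedForm_isHomogeneous a₀ a₁
  rw [mem_syzygyPiece] at hv
  obtain ⟨u₀, h₀, u₁, h₁, u₂, h₂, rfl⟩ :=
    exists_freePiece_eq_smul_add a₀ a₁ (hg.degree_le (by omega)) hv.1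
  have hrel := hv.2
  simp only [map_add, map_smul, smul_eq_mul] at hrel
  have htw (d : ℕ) : twistedPiece k 0 d = homogeneousSubmodule (Fin 3) k d := by
    simp [twistedPiece]
  obtain ⟨c, d, e, hc, hd, he, E₀, E₁, E₂⟩ := exists_koszul_twistedPiece (β := 0) a₀ a₁
    (t := t + 1)
    (by rw [htw]; exact rowMap_isHomogeneous hg.isHomogeneous h₀)
    (by rw [htw]; exact rowMap_isHomogeneous hg.isHomogeneous h₁)
    (by rw [htw]; exact rowMap_isHomogeneous hg.isHomogeneous h₂) hrel
  rw [htw] at hc hd he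
  obtain ⟨q, hq, hqI⟩ := hI.exists_sub_mem t (by omega) c hc
  have hmul {ℓ q : MvPolynomial (Fin 3) k} (hℓ : ℓ.IsHomogeneous 1) (hq : q.IsHomogeneous t) :
      (ℓ * q).IsHomogeneous (t + 1) := by
    rw [add_comm]; exact hℓ.mul hq
  have hdI : d + X 1 * q ∈ I := by
    refine hI.mem_of_mul_mem _ ?_
    convert I.sub_mem (hg.rowMap_mem u₀) (I.mul_mem_left (X 1) hqI) using 1
    rw [E₀]
    ring
  have heI : e - X 0 * q ∈ I := by
    refine hI.mem_of_mul_mem _ ?_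
    convert I.add_mem (hg.rowMap_mem u₁) (I.mul_mem_left (X 0) hqI) using 1
    rw [E₁]
    ring
  have lift := hg.exists_of_le hI (t := t + 1) (by omega)
  obtain ⟨p, hp, ep⟩ := lift _ hqI (hc.sub (hmul hℓ hq))
  obtain ⟨p', hp', ep'⟩ := lift _ hdI (hd.add (hmul (hX 1) hq))
  obtain ⟨p'', hp'', ep''⟩ := lift _ heI (he.sub (hmul (hX 0) hq))
  refine ⟨u₀ - (X 1 : MvPolynomial (Fin 3) k) • p - slantedForm a₀ a₁ • p',
    mem_syzygyPiece.2 ⟨sub_mem (sub_mem h₀ (smul_mem_freePiece (hX 1) hp))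
      (smul_mem_freePiece hℓ hp'), ?_⟩,
    u₁ + (X 0 : MvPolynomial (Fin 3) k) • p - slantedForm a₀ a₁ • p'',
    mem_syzygyPiece.2 ⟨sub_mem (add_mem h₁ (smul_mem_freePiece (hX 0) hp))
      (smul_mem_freePiece hℓ hp''), ?_⟩,
    u₂ + (X 0 : MvPolynomial (Fin 3) k) • p' + (X 1 : MvPolynomial (Fin 3) k) • p'',
    mem_syzygyPiece.2 ⟨add_mem (add_mem h₂ (smul_mem_freePiece (hX 0) hp'))
      (smul_mem_freePiece (hX 1) hp''), ?_⟩, ?_⟩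
  · simp only [map_sub, map_smul, smul_eq_mul, E₀, ep, ep']
    ring
  · simp only [map_sub, map_add, map_smul, smul_eq_mul, E₁, ep, ep'']
    ring
  · simp only [map_add, map_smul, smul_eq_mul, E₂, ep', ep'']
    ring
  · module

/-- The syzygies of degree `s + 1` satisfy no linear relations. -/
theorem IsGeneratorSystem.eq_zero_of_smul_add_eq_zero (hg : IsGeneratorSystem I s g b)
    (hI : HasRegularSection I s a₀ a₁) {u₀ u₁ u₂ : Fin N → MvPolynomial (Fin 3) k}
    (h₀ : u₀ ∈ syzygyPiece g b (s + 1)) (h₁ : u₁ ∈ syzygyPiece g b (s + 1))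
    (h₂ : u₂ ∈ syzygyPiece g b (s + 1))
    (h : (X 0 : MvPolynomial (Fin 3) k) • u₀ + (X 1 : MvPolynomial (Fin 3) k) • u₁ +
      slantedForm a₀ a₁ • u₂ = 0) : u₀ = 0 ∧ u₁ = 0 ∧ u₂ = 0 := by
  rw [mem_syzygyPiece] at h₀ h₁ h₂
  obtain ⟨c, hc, d, hd, e, he, rfl, rfl, rfl⟩ := exists_koszul_freePiece a₀ a₁ h₀.1 h₁.1 h₂.1 h
  have r₀ := h₀.2
  have r₁ := h₁.2
  simp only [map_add, map_neg, map_smul, smul_eq_mul] at r₀ r₁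
  have hcg : rowMap g c = 0 := by
    obtain ⟨q, hq⟩ : X 1 ∣ rowMap g d := by
      refine (X_prime.dvd_or_dvd (a := slantedForm a₀ a₁) ⟨-rowMap g c, ?_⟩).resolve_left
        (not_X_one_dvd_slantedForm a₀ a₁)
      linear_combination r₀
    have hcq : rowMap g c = -(slantedForm a₀ a₁ * q) := by
      have : (X 1 : MvPolynomial (Fin 3) k) * (rowMap g c + slantedForm a₀ a₁ * q) = 0 := by
        rw [hq] at r₀
        linear_combination r₀
      linear_combination (mul_eq_zero.1 this).resolve_left (X_ne_zero _)
    have hqI : q ∈ I := hI.mem_of_mul_mem _ (by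
      have := I.neg_mem (hg.rowMap_mem c)
      rwa [hcq, neg_neg] at this)
    have hchom := rowMap_isHomogeneous hg.isHomogeneous hc
    rcases Nat.eq_zero_or_pos s with rfl | hs
    · rw [← homogeneousComponent_eq_self hchom, hcq]
      simp [slantedForm, ← constantCoeff_eq]
    · obtain ⟨s, rfl⟩ : ∃ r, s = r + 1 := ⟨s - 1, by omega⟩
      rw [← homogeneousComponent_eq_self hchom, hcq, map_neg,
        homogeneousComponent_mul_of_isHomogeneous (slantedForm_isHomogeneous a₀ a₁),
        hI.eq_zero _ (hI.homogeneousComponent_mem q hqI s) s (by omega)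
          (homogeneousComponent_isHomogeneous _ _), mul_zero, neg_zero]
  have hdg : rowMap g d = 0 := by
    rw [hcg, mul_zero, zero_add] at r₀
    exact (mul_eq_zero.1 r₀).resolve_left (slantedForm_ne_zero _ _)
  have heg : rowMap g e = 0 := by
    rw [hcg, mul_zero, neg_zero, zero_add] at r₁
    exact (mul_eq_zero.1 r₁).resolve_left (slantedForm_ne_zero _ _)
  rw [hg.independent c hc hcg, hg.independent d hd hdg, hg.independent e he heg]
  simp

end Syzygies

section LinearAlgebra

theorem Submodule.exists_fin_span_sup {K V : Type*} [Field K] [AddCommGroup V] [Module K V]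
    {P W : Submodule K V} [Module.Finite K W] {e : ℕ} (hPW : P ≤ W)
    (h : Module.finrank K W = Module.finrank K P + e) :
    ∃ q : Fin e → V, (∀ i, q i ∈ W) ∧ W ≤ P ⊔ Submodule.span K (Set.range q) := by
  have hcomap : Module.finrank K (P.submoduleOf W) = Module.finrank K P :=
    (Submodule.submoduleOfEquivOfLe hPW).finrank_eq
  have hquot : Module.finrank K (W ⧸ P.submoduleOf W) = e := by
    have := (P.submoduleOf W).finrank_quotient_add_finrank
    omega
  let B := Module.finBasisOfFinrankEq K _ hquot
  choose q hq using fun i => (P.submoduleOf W).mkQ_surjective (B i)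
  refine ⟨fun i => q i, fun i => (q i).2, fun w hw => ?_⟩
  have hsum := B.sum_repr ((P.submoduleOf W).mkQ ⟨w, hw⟩)
  simp only [← hq, ← map_smul, ← map_sum] at hsum
  have hdiff := Submodule.mem_comap.1 ((Submodule.Quotient.eq _).1 hsum.symm)
  refine Submodule.mem_sup.2 ⟨_, hdiff,
    ∑ i, B.repr ((P.submoduleOf W).mkQ ⟨w, hw⟩) i • (q i : V),
    Submodule.sum_mem _ fun i _ => Submodule.smul_mem _ _ (Submodule.subset_span ⟨i, rfl⟩), ?_⟩
  simp

end LinearAlgebra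

section Resolution

variable {k : Type*} [Field k] {N : ℕ}

theorem finrank_twistedPiece (b t : ℕ) : Module.finrank k (twistedPiece k b t) =
    if b ≤ t then (t - b + 2).choose 2 else 0 := by
  split_ifs with h
  · rw [twistedPiece, if_pos h, finrank_homogeneousSubmodule_fin_three]
  · rw [twistedPiece, if_neg h, finrank_bot]

instance (b t : ℕ) : Module.Finite k (twistedPiece k b t) := by
  by_cases h : b ≤ t
  · rw [twistedPiece, if_pos h]
    infer_instance
  · rw [twistedPiece, if_neg h]
    infer_instance

/-- The degree `t` piece of `⊕ᵢ R(-bᵢ)` as a product of graded pieces. -/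
noncomputable def freePieceEquiv (b : Fin N → ℕ) (t : ℕ) :
    freePiece k b t ≃ₗ[k] ((i : Fin N) → twistedPiece k (b i) t) where
  toFun v i := ⟨v.1 i, mem_freePiece.1 v.2 i⟩
  invFun v := ⟨fun i => v i, mem_freePiece.2 fun i => (v i).2⟩
  map_add' _ _ := rfl
  map_smul' _ _ := rfl
  left_inv _ := rfl
  right_inv _ := rfl

instance (b : Fin N → ℕ) (t : ℕ) : Module.Finite k (freePiece k b t) :=
  Module.Finite.equiv (freePieceEquiv b t).symm

theorem finrank_freePiece (b : Fin N → ℕ) (t : ℕ) : Module.finrank k (freePiece k b t) =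
    ∑ i, if b i ≤ t then (t - b i + 2).choose 2 else 0 := by
  simp [(freePieceEquiv b t).finrank_eq, Module.finrank_pi_fintype, finrank_twistedPiece]

instance (g : Fin N → MvPolynomial (Fin 3) k) (b : Fin N → ℕ) (t : ℕ) :
    Module.Finite k (syzygyPiece g b t) :=
  Submodule.finiteDimensional_of_le (inf_le_left : syzygyPiece g b t ≤ freePiece k b t)

instance (I : Ideal (MvPolynomial (Fin 3) k)) (t : ℕ) : Module.Finite k (gradedPiece I t) :=
  Submodule.finiteDimensional_of_le
    (inf_le_right : gradedPiece I t ≤ homogeneousSubmodule (Fin 3) k t)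

theorem mem_gradedPiece {I : Ideal (MvPolynomial (Fin 3) k)} {t : ℕ}
    {f : MvPolynomial (Fin 3) k} : f ∈ gradedPiece I t ↔ f ∈ I ∧ f.IsHomogeneous t := by
  simp [gradedPiece]

variable {I : Ideal (MvPolynomial (Fin 3) k)} {s : ℕ} {a₀ a₁ : k}
  {g : Fin N → MvPolynomial (Fin 3) k} {b : Fin N → ℕ}

theorem IsGeneratorSystem.finrank_syzygyPiece (hg : IsGeneratorSystem I s g b)
    (hI : HasRegularSection I s a₀ a₁) {t : ℕ} (ht : s + 1 ≤ t) :
    Module.finrank k (gradedPiece I t) + Module.finrank k (syzygyPiece g b t) =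
      ∑ i, (t - b i + 2).choose 2 := by
  let F := ((rowMap g).restrictScalars k).domRestrict (freePiece k b t)
  have hrange : LinearMap.range F = gradedPiece I t := by
    ext f
    rw [mem_gradedPiece]
    constructor
    · rintro ⟨v, rfl⟩
      exact ⟨hg.rowMap_mem v, rowMap_isHomogeneous hg.isHomogeneous v.2⟩
    · rintro ⟨hf, hf'⟩
      obtain ⟨v, hv, rfl⟩ := hg.exists_of_le hI ht f hf hf'
      exact ⟨⟨v, hv⟩, rfl⟩
  have hker : LinearMap.ker F = (syzygyPiece g b t).submoduleOf (freePiece k b t) := by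
    ext v
    exact ⟨fun h => mem_syzygyPiece.2 ⟨v.2, h⟩, fun h => (mem_syzygyPiece.1 h).2⟩
  have hle : syzygyPiece g b t ≤ freePiece k b t := inf_le_left
  have := F.finrank_range_add_finrank_ker
  rw [hrange, hker, (Submodule.submoduleOfEquivOfLe hle).finrank_eq, finrank_freePiece] at this
  rw [this]
  exact Finset.sum_congr rfl fun i _ => if_pos (hg.degree_le ht i)

/-- The homogeneous component of degree `t` of an element of `⊕ᵢ R(-bᵢ)`. -/
noncomputable def freeComponent (b : Fin N → ℕ) (t : ℕ) (v : Fin N → MvPolynomial (Fin 3) k) :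
    Fin N → MvPolynomial (Fin 3) k :=
  fun i => if b i ≤ t then homogeneousComponent (t - b i) (v i) else 0

theorem freeComponent_mem_freePiece (b : Fin N → ℕ) (t : ℕ)
    (v : Fin N → MvPolynomial (Fin 3) k) : freeComponent b t v ∈ freePiece k b t := by
  refine mem_freePiece.2 fun i => ?_
  unfold freeComponent twistedPiece
  split_ifs
  · exact homogeneousComponent_mem _ _
  · exact zero_mem _

theorem rowMap_freeComponent (hg : ∀ i, (g i).IsHomogeneous (b i)) (t : ℕ)
    (v : Fin N → MvPolynomial (Fin 3) k) :
    rowMap g (freeComponent b t v) = homogeneousComponent t (rowMap g v) := by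
  rw [rowMap_apply, rowMap_apply, map_sum]
  refine Finset.sum_congr rfl fun i _ => ?_
  unfold freeComponent
  split_ifs with h
  · have := homogeneousComponent_mul_of_isHomogeneous (hg i) (v i) (t - b i)
    rw [Nat.sub_add_cancel h] at this
    exact this.symm
  · let := MvPolynomial.gradedAlgebra (σ := Fin 3) (R := k)
    have := DirectSum.coe_decompose_mul_of_left_mem_of_not_le
      (homogeneousSubmodule (Fin 3) k) (b := v i) (hg i) h
    rw [mul_zero, ← this]
    exact decomposition.decompose'_apply _ _

theorem exists_sum_freeComponent_eq (b : Fin N → ℕ) (v : Fin N → MvPolynomial (Fin 3) k) :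
    ∃ T, ∑ t ∈ Finset.range T, freeComponent b t v = v := by
  refine ⟨∑ i, ((v i).totalDegree + b i + 1), funext fun i => ?_⟩
  rw [Finset.sum_apply]
  ext d
  rw [coeff_sum, Finset.sum_eq_single (d.degree + b i)]
  · simp [freeComponent, coeff_homogeneousComponent]
  · intro t _ ht
    unfold freeComponent
    split_ifs with h
    · rw [coeff_homogeneousComponent, if_neg (by omega)]
    · simp
  · intro hd
    have hle := Finset.single_le_sum (f := fun i => (v i).totalDegree + b i + 1)
      (fun _ _ => Nat.zero_le _) (Finset.mem_univ i)
    rw [Finset.mem_range, not_lt] at hd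
    simp only [freeComponent, Nat.le_add_left, if_true, Nat.add_sub_cancel]
    rw [homogeneousComponent_eq_zero _ _ (by omega), coeff_zero]

theorem ker_rowMap_le_of_syzygyPiece_le (hg : ∀ i, (g i).IsHomogeneous (b i))
    {S : Submodule (MvPolynomial (Fin 3) k) (Fin N → MvPolynomial (Fin 3) k)}
    (h : ∀ t, ∀ v ∈ syzygyPiece g b t, v ∈ S) : LinearMap.ker (rowMap g) ≤ S := by
  intro v hv
  obtain ⟨T, hT⟩ := exists_sum_freeComponent_eq b v
  rw [← hT]
  refine Submodule.sum_mem _ fun t _ => h t _ (mem_syzygyPiece.2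
    ⟨freeComponent_mem_freePiece b t v, ?_⟩)
  rw [rowMap_freeComponent hg, LinearMap.mem_ker.1 hv, map_zero]

/-- A matrix with one column less than there are generators, whose columns span the syzygies, has
linearly independent columns. -/
theorem injective_mulVecLin_of_range_eq_ker {A : Type*} [CommRing A] [IsDomain A] {M : ℕ}
    {g : Fin (M + 1) → A} {φ : Matrix (Fin (M + 1)) (Fin M) A}
    (h : LinearMap.range φ.mulVecLin = LinearMap.ker (rowMap g)) :
    Function.Injective φ.mulVecLin := by
  have hker : M ≤ Module.finrank A (LinearMap.ker (rowMap g)) := by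
    have h1 := (LinearMap.ker (rowMap g)).finrank_quotient_add_finrank
    rw [(rowMap g).quotKerEquivRange.finrank_eq, Module.finrank_fin_fun] at h1
    have h2 := (LinearMap.range (rowMap g)).finrank_le
    rw [Module.finrank_self] at h2
    omega
  have hdisj := Submodule.disjoint_ker_of_finrank_le (L := ⊤) φ.mulVecLin (by
    rw [Submodule.map_top, h, finrank_top, Module.finrank_fin_fun]
    exact hker)
  rwa [top_disjoint, LinearMap.ker_eq_bot] at hdisj

/-- The map `(u₀, u₁, u₂) ↦ x u₀ + y u₁ + ℓ u₂` for the linear form `ℓ = z + a₀ x + a₁ y`. -/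
noncomputable def linearCombinationMap (N : ℕ) (a₀ a₁ : k) :
    (Fin N → MvPolynomial (Fin 3) k) × (Fin N → MvPolynomial (Fin 3) k) ×
      (Fin N → MvPolynomial (Fin 3) k) →ₗ[k] (Fin N → MvPolynomial (Fin 3) k) where
  toFun u := (X 0 : MvPolynomial (Fin 3) k) • u.1 + (X 1 : MvPolynomial (Fin 3) k) • u.2.1 +
    slantedForm a₀ a₁ • u.2.2
  map_add' u v := by simp only [Prod.fst_add, Prod.snd_add]; module
  map_smul' c u := by
    simp only [Prod.smul_fst, Prod.smul_snd, RingHom.id_apply, smul_add, smul_comm c]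

theorem IsGeneratorSystem.hasResolutionData (hg : IsGeneratorSystem I s g b)
    (hI : HasRegularSection I s a₀ a₁) {m₁ m₂ M : ℕ} (hN : N = M + 1) (hM : M = m₁ + m₂)
    (hmin : m₁ = 0 ∨ ∀ i, b i = s)
    (h₁ : Module.finrank k (syzygyPiece g b (s + 1)) = m₁)
    (h₂ : Module.finrank k (syzygyPiece g b (s + 2)) = 3 * m₁ + m₂) :
    HasResolutionData I b (fun j : Fin M => if (j : ℕ) < m₁ then s + 1 else s + 2) := by
  subst hN
  have hX (i : Fin 3) : (X i : MvPolynomial (Fin 3) k).IsHomogeneous 1 := isHomogeneous_X k i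
  have hℓ := slantedForm_isHomogeneous a₀ a₁
  obtain ⟨q₁, hq₁, hspan₁⟩ := Submodule.exists_fin_span_sup
    (bot_le : ⊥ ≤ syzygyPiece g b (s + 1)) (e := m₁) (by rw [h₁, finrank_bot, zero_add])
  rw [bot_sup_eq] at hspan₁
  let K := syzygyPiece g b (s + 1)
  let P := LinearMap.range ((linearCombinationMap (M + 1) a₀ a₁) ∘ₗ
    K.subtype.prodMap (K.subtype.prodMap K.subtype))
  have hPle : P ≤ syzygyPiece g b (s + 2) := by
    rintro _ ⟨⟨u₀, u₁, u₂⟩, rfl⟩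
    exact add_mem (add_mem (smul_mem_syzygyPiece (hX 0) u₀.2)
      (smul_mem_syzygyPiece (hX 1) u₁.2)) (smul_mem_syzygyPiece hℓ u₂.2)
  have hP : Module.finrank k P = 3 * m₁ := by
    rw [LinearMap.finrank_range_of_inj, Module.finrank_prod, Module.finrank_prod, h₁]
    · ring
    · refine (injective_iff_map_eq_zero _).2 ?_
      rintro ⟨u₀, u₁, u₂⟩ hu
      obtain ⟨h₀, h₁, h₂⟩ := hg.eq_zero_of_smul_add_eq_zero hI u₀.2 u₁.2 u₂.2 hu
      exact Prod.ext (Subtype.ext h₀) (Prod.ext (Subtype.ext h₁) (Subtype.ext h₂))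
  obtain ⟨q₂, hq₂, hspan₂⟩ := Submodule.exists_fin_span_sup hPle (e := m₂) (by rw [h₂, hP])
  let col (j : Fin M) : Fin (M + 1) → MvPolynomial (Fin 3) k :=
    if h : (j : ℕ) < m₁ then q₁ ⟨j, h⟩ else q₂ ⟨j - m₁, by omega⟩
  let φ : Matrix (Fin (M + 1)) (Fin M) (MvPolynomial (Fin 3) k) := Matrix.of fun i j => col j i
  have hcol (j : Fin M) : col j ∈ syzygyPiece g b (if (j : ℕ) < m₁ then s + 1 else s + 2) := by
    unfold col
    split_ifs
    · exact hq₁ _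
    · exact hq₂ _
  have hrange : LinearMap.range φ.mulVecLin = LinearMap.ker (rowMap g) := by
    rw [Matrix.range_mulVecLin]
    apply le_antisymm
    · rw [Submodule.span_le]
      rintro _ ⟨j, rfl⟩
      exact LinearMap.mem_ker.2 (mem_syzygyPiece.1 (hcol j)).2
    · apply ker_rowMap_le_of_syzygyPiece_le hg.isHomogeneous
      have mem₁ (j : Fin m₁) : q₁ j ∈ Submodule.span (MvPolynomial (Fin 3) k) (Set.range φ.col) :=
        Submodule.subset_span ⟨⟨j, by omega⟩, by funext i; simp [φ, col]⟩
      have mem₂ (j : Fin m₂) : q₂ j ∈ Submodule.span (MvPolynomial (Fin 3) k) (Set.range φ.col) :=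
        Submodule.subset_span ⟨⟨m₁ + j, by omega⟩, by funext i; simp [φ, col]⟩
      have le₁ : syzygyPiece g b (s + 1) ≤ (Submodule.span (MvPolynomial (Fin 3) k)
          (Set.range φ.col)).restrictScalars k := by
        refine hspan₁.trans (Submodule.span_le.2 ?_)
        rintro _ ⟨j, rfl⟩
        exact mem₁ j
      have comb {u₀ u₁ u₂ : Fin (M + 1) → MvPolynomial (Fin 3) k}
          (S : Submodule (MvPolynomial (Fin 3) k) (Fin (M + 1) → MvPolynomial (Fin 3) k))
          (h₀ : u₀ ∈ S) (h₁ : u₁ ∈ S) (h₂ : u₂ ∈ S) :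
          (X 0 : MvPolynomial (Fin 3) k) • u₀ + (X 1 : MvPolynomial (Fin 3) k) • u₁ +
            slantedForm a₀ a₁ • u₂ ∈ S :=
        add_mem (add_mem (S.smul_mem _ h₀) (S.smul_mem _ h₁)) (S.smul_mem _ h₂)
      have le₂ : syzygyPiece g b (s + 2) ≤ (Submodule.span (MvPolynomial (Fin 3) k)
          (Set.range φ.col)).restrictScalars k := by
        refine hspan₂.trans (sup_le ?_ (Submodule.span_le.2 ?_))
        · rintro _ ⟨⟨u₀, u₁, u₂⟩, rfl⟩
          exact comb _ (le₁ u₀.2) (le₁ u₁.2) (le₁ u₂.2)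
        · rintro _ ⟨j, rfl⟩
          exact mem₂ j
      intro t
      rcases le_or_gt t s with ht | ht
      · rw [hg.syzygyPiece_eq_bot ht]
        intro v hv
        rw [(Submodule.mem_bot k).1 hv]
        exact zero_mem _
      · rcases (Nat.succ_le_of_lt ht).eq_or_lt with rfl | ht
        · exact fun v hv => le₁ hv
        · induction t, (show s + 2 ≤ t from ht) using Nat.le_induction with
          | base => exact fun v hv => le₂ hv
          | succ t ht' ih =>
            intro v hv
            obtain ⟨u₀, h₀, u₁, h₁, u₂, h₂, rfl⟩ := hg.exists_syzygyPiece_eq_smul_add hI ht' hv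
            exact comb _ (ih (by omega) (by omega) _ h₀) (ih (by omega) (by omega) _ h₁)
              (ih (by omega) (by omega) _ h₂)
  refine ⟨g, φ, hg.isHomogeneous, hg.span_range_eq hI, fun i j => ?_,
    injective_mulVecLin_of_range_eq_ker hrange, hrange⟩
  have hij := mem_freePiece.1 (mem_syzygyPiece.1 (hcol j)).1 i
  have hlt : b i < if (j : ℕ) < m₁ then s + 1 else s + 2 := by
    have := hg.degree i
    rcases hmin with rfl | hmin
    · rw [if_neg (Nat.not_lt_zero _)]
      omega
    · rw [hmin i]
      split_ifs <;> omega
  rw [twistedPiece, if_pos hlt.le] at hij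
  exact ⟨hij, fun h => absurd h (not_le.2 hlt)⟩

end Resolution

section TightGenericPosition

variable {k : Type*} [Field k]

theorem exists_hasRegularSection_vanishingIdeal [Infinite k] {n s : ℕ} {pts : Fin n → (Fin 3 → k)}
    (hpts : ∀ i, pts i ≠ 0) (hgen : InGenericPosition pts)
    (hindeg : HasInitialDegree (vanishingIdeal pts) s) (hn : n ≤ (s + 2).choose 2) :
    ∃ a₀ a₁, HasRegularSection (vanishingIdeal pts) s a₀ a₁ := by
  obtain ⟨a₀, a₁, hne⟩ := exists_slantedForm_eval_ne_zero pts hpts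
  have hcancel (f : MvPolynomial (Fin 3) k) (hf : slantedForm a₀ a₁ * f ∈ vanishingIdeal pts) :
      f ∈ vanishingIdeal pts := by
    rw [_root_.vanishingIdeal, Submodule.mem_iInf] at hf ⊢
    exact fun i => mem_pointIdeal_of_mul_mem (hpts i) (slantedForm_isHomogeneous a₀ a₁) (hne i)
      (hf i)
  refine ⟨a₀, a₁, fun f hf t => homogeneousComponent_mem_vanishingIdeal pts hf t, hcancel,
    fun t ht f hf => ?_, fun f hf t ht hft => ?_⟩
  · let μ := LinearMap.mulLeft k (slantedForm a₀ a₁)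
    have hμ : Function.Injective μ := mul_right_injective₀ (slantedForm_ne_zero a₀ a₁)
    let A := (homogeneousSubmodule (Fin 3) k t).map μ
    let B := gradedPiece (vanishingIdeal pts) (t + 1)
    have hA : Module.finrank k A = (t + 2).choose 2 := by
      rw [← finrank_homogeneousSubmodule_fin_three (k := k) t]
      exact (Submodule.equivMapOfInjective μ hμ _).finrank_eq.symm
    have hAB : Module.finrank k (A ⊓ B : Submodule k _) ≤ (t + 2).choose 2 - n := by
      rw [← hgen t]
      refine (Submodule.finrank_mono ?_).trans (Submodule.finrank_map_le μ _)
      rintro _ ⟨⟨c, hc, rfl⟩, hc'⟩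
      exact ⟨c, mem_gradedPiece.2 ⟨hcancel c (mem_gradedPiece.1 hc').1, hc⟩, rfl⟩
    have hle : A ⊔ B ≤ homogeneousSubmodule (Fin 3) k (t + 1) := by
      refine sup_le ?_ inf_le_right
      rintro _ ⟨c, hc, rfl⟩
      have := (slantedForm_isHomogeneous a₀ a₁).mul hc
      rwa [add_comm] at this
    have hsup : A ⊔ B = homogeneousSubmodule (Fin 3) k (t + 1) := by
      refine Submodule.eq_of_le_of_finrank_le hle ?_
      have h1 := Submodule.finrank_sup_add_finrank_inf_eq A B
      have h2 : Module.finrank k B = _ := hgen (t + 1)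
      have h3 := Nat.choose_le_choose 2 (Nat.add_le_add_right ht 2)
      have h4 := Nat.choose_le_choose 2 (Nat.le_succ (t + 2))
      rw [finrank_homogeneousSubmodule_fin_three]
      simp only [Nat.succ_eq_add_one, show t + 1 + 2 = t + 2 + 1 by ring] at *
      omega
    have hf' : f ∈ A ⊔ B := hsup ▸ hf
    obtain ⟨_, ⟨c, hc, rfl⟩, d, hd, rfl⟩ := Submodule.mem_sup.1 hf'
    refine ⟨c, hc, ?_⟩
    simpa [μ] using (mem_gradedPiece.1 hd).1
  · have : f ∈ gradedPiece (vanishingIdeal pts) t := mem_gradedPiece.2 ⟨hf, hft⟩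
    rwa [hindeg.2 t ht, Submodule.mem_bot] at this

theorem oneTimesPiece_le_gradedPiece (I : Ideal (MvPolynomial (Fin 3) k)) (s : ℕ) :
    oneTimesPiece I s ≤ gradedPiece I (s + 1) := by
  refine Submodule.span_le.2 ?_
  rintro _ ⟨ℓ, f, hℓ, hf, rfl⟩
  rw [mem_gradedPiece] at hf
  refine mem_gradedPiece.2 ⟨I.mul_mem_left ℓ hf.1, ?_⟩
  have := IsHomogeneous.mul hℓ hf.2
  rwa [add_comm] at this

theorem exists_isGeneratorSystem {I : Ideal (MvPolynomial (Fin 3) k)} {s d e N : ℕ}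
    (hN : N = d + e) (hd : Module.finrank k (gradedPiece I s) = d)
    (he : Module.finrank k (gradedPiece I (s + 1)) =
      Module.finrank k (oneTimesPiece I s) + e) :
    ∃ g : Fin N → MvPolynomial (Fin 3) k,
      IsGeneratorSystem I s g fun i => if (i : ℕ) < d then s else s + 1 := by
  subst hN
  let B := Module.finBasisOfFinrankEq k _ hd
  obtain ⟨q, hq, hspan⟩ := Submodule.exists_fin_span_sup (oneTimesPiece_le_gradedPiece I s) he
  let b (i : Fin (d + e)) : ℕ := if (i : ℕ) < d then s else s + 1
  let g : Fin (d + e) → MvPolynomial (Fin 3) k :=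
    Fin.append (fun i => (B i : MvPolynomial (Fin 3) k)) q
  have hbl (i : Fin d) : b (Fin.castAdd e i) = s := by simp [b]
  have hbr (i : Fin e) : b (Fin.natAdd d i) = s + 1 := by simp [b]
  have hg (i : Fin (d + e)) : g i ∈ gradedPiece I (b i) := by
    induction i using Fin.addCases with
    | left i =>
      simp only [hbl, g, Fin.append_left]
      exact (B i).2
    | right i =>
      simp only [hbr, g, Fin.append_right]
      exact hq i
  have initial (f : MvPolynomial (Fin 3) k) (hf : f ∈ gradedPiece I s) :
      ∃ v ∈ freePiece k b s, rowMap g v = f := by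
    refine ⟨Fin.append (fun i => C (B.repr ⟨f, hf⟩ i)) 0, mem_freePiece.2 fun i => ?_, ?_⟩
    · induction i using Fin.addCases with
      | left i =>
        rw [hbl, Fin.append_left, twistedPiece, if_pos le_rfl, Nat.sub_self]
        exact isHomogeneous_C _ _
      | right i =>
        rw [Fin.append_right]
        exact zero_mem _
    · refine Eq.trans ?_ (congrArg Subtype.val (B.sum_repr ⟨f, hf⟩))
      rw [rowMap_apply, Fin.sum_univ_add, AddSubmonoidClass.coe_finsetSum]
      simp [g, smul_eq_C_mul, mul_comm]
  refine ⟨g, fun i => ?_, fun i => (mem_gradedPiece.1 (hg i)).2,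
    fun i => (mem_gradedPiece.1 (hg i)).1, fun f hf hfs => initial f (mem_gradedPiece.2 ⟨hf, hfs⟩),
    fun f hf hfs => ?_, fun v hv hv0 => ?_⟩
  · split_ifs <;> simp
  · suffices h : gradedPiece I (s + 1) ≤
        (freePiece k b (s + 1)).map ((rowMap g).restrictScalars k) from
      h (mem_gradedPiece.2 ⟨hf, hfs⟩)
    refine hspan.trans (sup_le (Submodule.span_le.2 ?_) (Submodule.span_le.2 ?_))
    · rintro _ ⟨ℓ, f, hℓ, hf, rfl⟩
      obtain ⟨v, hv, rfl⟩ := initial f hf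
      exact ⟨ℓ • v, smul_mem_freePiece hℓ hv, map_smul (rowMap g) ℓ v⟩
    · rintro _ ⟨j, rfl⟩
      refine ⟨Pi.single (Fin.natAdd d j) 1, mem_freePiece.2 fun i => ?_, ?_⟩
      · rcases eq_or_ne i (Fin.natAdd d j) with rfl | hij
        · rw [hbr, Pi.single_eq_same, twistedPiece, if_pos le_rfl, Nat.sub_self]
          exact isHomogeneous_one _ _
        · rw [Pi.single_eq_of_ne hij]
          exact zero_mem _
      · simp [rowMap_apply, Pi.single_apply, g]
  · have hr (j : Fin e) : v (Fin.natAdd d j) = 0 := by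
      have := mem_freePiece.1 hv (Fin.natAdd d j)
      rwa [twistedPiece, if_neg (by simp), Submodule.mem_bot] at this
    have hl (j : Fin d) : v (Fin.castAdd e j) = C (coeff 0 (v (Fin.castAdd e j))) := by
      have := mem_freePiece.1 hv (Fin.castAdd e j)
      rw [twistedPiece, if_pos (by simp), show s - _ = 0 by simp] at this
      rw [← homogeneousComponent_zero, homogeneousComponent_of_mem this, if_pos rfl]
    have hsum : ∑ j, coeff 0 (v (Fin.castAdd e j)) • B j = 0 := by
      apply Subtype.ext
      rw [rowMap_apply, Fin.sum_univ_add] at hv0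
      simp only [hr, mul_zero, Finset.sum_const_zero, add_zero, g, Fin.append_left] at hv0
      rw [ZeroMemClass.coe_zero, ← hv0, AddSubmonoidClass.coe_finsetSum]
      refine Finset.sum_congr rfl fun j _ => ?_
      rw [hl j, mul_comm, SetLike.val_smul, smul_eq_C_mul, coeff_zero_C]
    have hzero := Fintype.linearIndependent_iff.1 B.linearIndependent _ hsum
    funext i
    induction i using Fin.addCases with
    | left i => rw [hl, hzero, C_0, Pi.zero_apply]
    | right i => exact hr i

theorem hasResolutionData_vanishingIdeal [Infinite k] {n s h N M : ℕ} {pts : Fin n → (Fin 3 → k)}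
    (hpts : ∀ i, pts i ≠ 0) (htight : InTightGenericPosition pts s)
    (hindeg : HasInitialDegree (vanishingIdeal pts) s) (hn : n = (s + 1).choose 2 + h)
    (hh : h ≤ s) (hN : N = (s - h + 1) + (2 * h - s)) (hM : M = (s - 2 * h) + h) :
    HasResolutionData (vanishingIdeal pts)
      (fun i : Fin N => if (i : ℕ) < s - h + 1 then s else s + 1)
      (fun j : Fin M => if (j : ℕ) < s - 2 * h then s + 1 else s + 2) := by
  have c₂ : (s + 2).choose 2 = (s + 1).choose 2 + (s + 1) := by
    rw [Nat.choose_succ_succ' (s + 1) 1, Nat.choose_one_right, add_comm]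
  have c₃ : (s + 3).choose 2 = (s + 2).choose 2 + (s + 2) := by
    rw [Nat.choose_succ_succ' (s + 2) 1, Nat.choose_one_right, add_comm]
  have c₄ : (s + 4).choose 2 = (s + 3).choose 2 + (s + 3) := by
    rw [Nat.choose_succ_succ' (s + 3) 1, Nat.choose_one_right, add_comm]
  have d₀ := htight.1 s
  have d₁ := htight.1 (s + 1)
  have d₂ := htight.1 (s + 2)
  have hone := htight.2
  rw [show s + 1 + 2 = s + 3 by ring] at d₁
  rw [show s + 2 + 2 = s + 4 by ring] at d₂
  obtain ⟨a₀, a₁, hI⟩ := exists_hasRegularSection_vanishingIdeal hpts htight.1 hindeg (by omega)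
  obtain ⟨g, hg⟩ := exists_isGeneratorSystem (I := vanishingIdeal pts) (s := s) hN (by omega)
    (by omega)
  have hsum (F : ℕ → ℕ) : ∑ i : Fin N, F (if (i : ℕ) < s - h + 1 then s else s + 1) =
      (s - h + 1) * F s + (2 * h - s) * F (s + 1) := by
    subst hN
    generalize s - h + 1 = d
    simp [Fin.sum_univ_add]
  replace d₁ := d₁.trans (show _ = 2 * s + 3 - h by omega)
  replace d₂ := d₂.trans (show _ = 3 * s + 6 - h by omega)
  have e₁ := hg.finrank_syzygyPiece hI (le_refl (s + 1))
  have e₂ := hg.finrank_syzygyPiece hI (t := s + 2) (by omega)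
  rw [d₁, hsum fun b => (s + 1 - b + 2).choose 2] at e₁
  rw [d₂, hsum fun b => (s + 2 - b + 2).choose 2] at e₂
  simp only [show s + 1 - s = 1 by omega, show s + 2 - s = 2 by omega,
    show s + 2 - (s + 1) = 1 by omega, Nat.sub_self, show (0 + 2).choose 2 = 1 by rfl,
    show (1 + 2).choose 2 = 3 by rfl, show (2 + 2).choose 2 = 6 by rfl] at e₁ e₂
  clear d₀ d₁ d₂ hone
  refine hg.hasResolutionData hI (by omega) hM ?_ (by clear e₂; omega) (by clear e₁; omega)
  clear e₁ e₂
  rcases le_or_gt (2 * h) s with hs | hs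
  · refine Or.inr fun i => if_pos ?_
    omega
  · exact Or.inl (by omega)

end TightGenericPosition

/-- Let `I ⊂ k[x,y,z]` be the radical ideal of `n` distinct points of `ℙ²`
in tight generic `n`-position, initial degree `s ≥ 2`, `n = C(s+1,2) + h`, `0 ≤ h ≤ s`.
Then the minimal graded free resolution of `I` is
`0 → R(−s−1)^{s−2h} ⊕ R(−s−2)^h → R(−s)^{s−h+1} → I → 0` if `2h ≤ s`, and
`0 → R(−s−2)^h → R(−s)^{s−h+1} ⊕ R(−s−1)^{2h−s} → I → 0` if `s < 2h`.  In particular `I`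
is minimally generated by `s−h+1` forms of degree `s` (plus `2h−s` forms of degree `s+1`
in the second case). -/
theorem statement13 {k : Type*} [Field k] [IsAlgClosed k] {n s h : ℕ}
    (pts : Fin n → (Fin 3 → k)) (hfam : IsPointFamily pts)
    (htight : InTightGenericPosition pts s)
    (hindeg : HasInitialDegree (vanishingIdeal pts) s)
    (hs : 2 ≤ s) (hn : n = (s + 1).choose 2 + h) (hh : h ≤ s) :
    (2 * h ≤ s →
      HasResolutionData (vanishingIdeal pts)
        (fun _ : Fin (s - h + 1) => s)
        (fun j : Fin (s - h) => if (j : ℕ) < s - 2 * h then s + 1 else s + 2)) ∧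
    (s < 2 * h →
      HasResolutionData (vanishingIdeal pts)
        (fun i : Fin (h + 1) => if (i : ℕ) < s - h + 1 then s else s + 1)
        (fun _ : Fin h => s + 2)) := by
  have := IsAlgClosed.instInfinite (K := k)
  constructor
  · intro hhs
    convert hasResolutionData_vanishingIdeal (N := s - h + 1) (M := s - h) hfam.1 htight hindeg hn
      hh (by omega) (by omega) using 2 with i
    exact (if_pos i.2).symm
  · intro hhs
    convert hasResolutionData_vanishingIdeal (N := h + 1) (M := h) hfam.1 htight hindeg hn
      hh (by omega) (by omega) using 2 with j
    exact (if_neg (by omega)).symm
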